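/- For every integer n ≥ 1 and every γ > 0, P( −log₂ P(Z = h(Ξ)) − H(Z) > c·√( m·ln(√n/γ)/2 ) ) ≤ γ/√n. -/

import Mathlib

open Real Finset
open scoped Classical

/-- Hoeffding's lemma on a finite probability space. -/
theorem sum_mul_exp_sub_mean_le {α : Type*} [Fintype α] (p : α → ℝ) (hp0 : ∀ a, 0 ≤ p a)
    (hp1 : ∑ a, p a = 1) (f : α → ℝ) (c : ℝ) (hf : ∀ a b, |f a - f b| ≤ c) (s : ℝ) :
    ∑ a, p a * exp (s * (f a - ∑ b, p b * f b)) ≤ exp (c ^ 2 * s ^ 2 / 8) := by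
  let _ : MeasurableSpace α := ⊤
  have : Nonempty α := by
    by_contra hα
    rw [not_nonempty_iff] at hα
    simp at hp1
  obtain ⟨a₀, ha₀⟩ := Finite.exists_min f
  have hsum : ∑ a, ENNReal.ofReal (p a) = 1 := by
    rw [← ENNReal.ofReal_sum_of_nonneg fun a _ => hp0 a, hp1, ENNReal.ofReal_one]
  let P : PMF α := PMF.ofFintype (fun a => ENNReal.ofReal (p a)) hsum
  have hP : ∀ g : α → ℝ, ∫ a, g a ∂P.toMeasure = ∑ a, p a * g a := fun g => by
    rw [PMF.integral_eq_sum]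
    exact Finset.sum_congr rfl fun a _ => by
      rw [PMF.ofFintype_apply, ENNReal.toReal_ofReal (hp0 a), smul_eq_mul]
  have hmem : ∀ a, f a ∈ Set.Icc (f a₀) (f a₀ + c) := fun a =>
    ⟨ha₀ a, by linarith [(abs_le.1 (hf a a₀)).2]⟩
  have hmgf := (ProbabilityTheory.hasSubgaussianMGF_of_mem_Icc (μ := P.toMeasure)
    (measurable_from_top (f := f)).aemeasurable (.of_forall hmem)).mgf_le s
  rw [ProbabilityTheory.mgf, hP, hP] at hmgf
  refine hmgf.trans_eq ?_
  congr 1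
  push_cast
  rw [add_sub_cancel_left, norm_eq_abs, div_pow, sq_abs]
  ring

/-- A weighted sum over a product space splits off the first coordinate. -/
theorem sum_prod_mul_succ {m : ℕ} (E : Fin (m + 1) → Type*) [∀ i, Fintype (E i)]
    (ν : ∀ i, E i → ℝ) (F : (∀ i, E i) → ℝ) :
    ∑ ξ, (∏ i, ν i (ξ i)) * F ξ =
      ∑ e, ν 0 e * ∑ η : ∀ i : Fin m, E i.succ, (∏ i, ν i.succ (η i)) * F (Fin.cons e η) := by
  rw [← (Fin.consEquiv E).sum_comp, Fintype.sum_prod_type]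
  refine Finset.sum_congr rfl fun e _ => ?_
  rw [Finset.mul_sum]
  refine Finset.sum_congr rfl fun η _ => ?_
  simp [Fin.consEquiv, Fin.prod_univ_succ, mul_assoc]

theorem sum_prod_eq_one {m : ℕ} (E : Fin m → Type*) [∀ i, Fintype (E i)]
    (ν : ∀ i, E i → ℝ) (hν1 : ∀ i, ∑ e, ν i e = 1) : ∑ ξ : ∀ i, E i, ∏ i, ν i (ξ i) = 1 := by
  rw [← Fintype.prod_sum]
  simp [hν1]

/-- The moment generating function bound behind McDiarmid's inequality, on a finite product. -/
theorem sum_prod_mul_exp_sub_mean_le (c s : ℝ) (m : ℕ) (E : Fin m → Type*)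
    [∀ i, Fintype (E i)] (ν : ∀ i, E i → ℝ) (hν0 : ∀ i e, 0 ≤ ν i e)
    (hν1 : ∀ i, ∑ e, ν i e = 1) (g : (∀ i, E i) → ℝ)
    (hg : ∀ (i : Fin m) (ξ ξ' : ∀ i, E i), (∀ j, j ≠ i → ξ j = ξ' j) → |g ξ - g ξ'| ≤ c) :
    ∑ ξ, (∏ i, ν i (ξ i)) * exp (s * (g ξ - ∑ η, (∏ i, ν i (η i)) * g η)) ≤
      exp (m * (c ^ 2 * s ^ 2 / 8)) := by
  induction m with
  | zero => simp
  | succ m ih =>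
    let w : (∀ i : Fin m, E i.succ) → ℝ := fun η => ∏ i, ν i.succ (η i)
    have hw0 : ∀ η, 0 ≤ w η := fun η => Finset.prod_nonneg fun i _ => hν0 _ _
    have hw1 : ∑ η, w η = 1 := sum_prod_eq_one _ _ fun i => hν1 i.succ
    let G : E 0 → ℝ := fun e => ∑ η, w η * g (Fin.cons e η)
    have hG : ∀ e e', |G e - G e'| ≤ c := fun e e' => calc
      |G e - G e'| = |∑ η, w η * (g (Fin.cons e η) - g (Fin.cons e' η))| := by
        simp only [G, mul_sub, Finset.sum_sub_distrib]
      _ ≤ ∑ η, |w η * (g (Fin.cons e η) - g (Fin.cons e' η))| := Finset.abs_sum_le_sum_abs _ _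
      _ ≤ ∑ η, w η * c := by
        refine Finset.sum_le_sum fun η _ => ?_
        rw [abs_mul, abs_of_nonneg (hw0 η)]
        refine mul_le_mul_of_nonneg_left (hg 0 _ _ fun j hj => ?_) (hw0 η)
        obtain ⟨k, rfl⟩ := Fin.exists_succ_eq.2 hj
        simp
      _ = c := by rw [← Finset.sum_mul, hw1, one_mul]
    have htail : ∀ e, ∑ η, w η * exp (s * (g (Fin.cons e η) - G e)) ≤
        exp (m * (c ^ 2 * s ^ 2 / 8)) := fun e =>
      ih (fun i => E i.succ) (fun i => ν i.succ) (fun i => hν0 _) (fun i => hν1 _)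
        (fun η => g (Fin.cons e η)) fun i η η' hη => hg i.succ _ _ fun j hj => by
          refine Fin.cases (fun _ => ?_) (fun k hk => ?_) j hj
          · simp
          · simpa using hη k fun hki => hk (by rw [hki])
    rw [sum_prod_mul_succ, sum_prod_mul_succ E ν g]
    change ∑ e, ν 0 e * ∑ η, w η * exp (s * (g (Fin.cons e η) - ∑ e', ν 0 e' * G e')) ≤ _
    calc
      _ = ∑ e, ν 0 e * exp (s * (G e - ∑ e', ν 0 e' * G e')) *
            ∑ η, w η * exp (s * (g (Fin.cons e η) - G e)) := by
        refine Finset.sum_congr rfl fun e _ => ?_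
        rw [mul_assoc, Finset.mul_sum (a := exp _)]
        congr 1
        refine Finset.sum_congr rfl fun η _ => ?_
        rw [mul_left_comm, ← exp_add]
        ring_nf
      _ ≤ ∑ e, ν 0 e * exp (s * (G e - ∑ e', ν 0 e' * G e')) *
            exp (m * (c ^ 2 * s ^ 2 / 8)) :=
        Finset.sum_le_sum fun e _ =>
          mul_le_mul_of_nonneg_left (htail e) (mul_nonneg (hν0 _ _) (exp_pos _).le)
      _ ≤ exp (c ^ 2 * s ^ 2 / 8) * exp (m * (c ^ 2 * s ^ 2 / 8)) := by
        rw [← Finset.sum_mul]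
        exact mul_le_mul_of_nonneg_right
          (sum_mul_exp_sub_mean_le _ (hν0 0) (hν1 0) G c hG s) (exp_pos _).le
      _ = _ := by
        rw [← exp_add]
        push_cast
        ring_nf

/-- McDiarmid's bounded-differences inequality on a finite product space. -/
theorem sum_filter_prod_le_of_bounded_differences (c : ℝ) (hc : 0 < c) (m : ℕ) (hm : 0 < m)
    (E : Fin m → Type*) [∀ i, Fintype (E i)] (ν : ∀ i, E i → ℝ) (hν0 : ∀ i e, 0 ≤ ν i e)
    (hν1 : ∀ i, ∑ e, ν i e = 1) (g : (∀ i, E i) → ℝ)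
    (hg : ∀ (i : Fin m) (ξ ξ' : ∀ i, E i), (∀ j, j ≠ i → ξ j = ξ' j) → |g ξ - g ξ'| ≤ c)
    (t : ℝ) (ht : 0 ≤ t) :
    ∑ ξ ∈ Finset.univ.filter (fun ξ => g ξ - ∑ η, (∏ i, ν i (η i)) * g η > t),
      ∏ i, ν i (ξ i) ≤ exp (-(2 * t ^ 2 / (m * c ^ 2))) := by
  have hm' : (0 : ℝ) < m := by exact_mod_cast hm
  set μ := ∑ η, (∏ i, ν i (η i)) * g η
  let s := 4 * t / (m * c ^ 2)
  have hs : 0 ≤ s := by positivity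
  have hw0 : ∀ ξ : ∀ i, E i, 0 ≤ ∏ i, ν i (ξ i) := fun ξ => Finset.prod_nonneg fun i _ => hν0 _ _
  calc
    _ ≤ ∑ ξ ∈ Finset.univ.filter (fun ξ => g ξ - μ > t),
          exp (-(s * t)) * ((∏ i, ν i (ξ i)) * exp (s * (g ξ - μ))) := by
      refine Finset.sum_le_sum fun ξ hξ => ?_
      rw [mul_left_comm, ← exp_add]
      refine le_mul_of_one_le_right (hw0 ξ) (one_le_exp ?_)
      have := mul_le_mul_of_nonneg_left (Finset.mem_filter.1 hξ).2.le hs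
      linarith
    _ ≤ ∑ ξ, exp (-(s * t)) * ((∏ i, ν i (ξ i)) * exp (s * (g ξ - μ))) :=
      Finset.sum_le_sum_of_subset_of_nonneg (Finset.filter_subset _ _) fun ξ _ _ =>
        mul_nonneg (exp_pos _).le (mul_nonneg (hw0 ξ) (exp_pos _).le)
    _ ≤ exp (-(s * t)) * exp (m * (c ^ 2 * s ^ 2 / 8)) := by
      rw [← Finset.mul_sum]
      exact mul_le_mul_of_nonneg_left
        (sum_prod_mul_exp_sub_mean_le c s m E ν hν0 hν1 g hg) (exp_pos _).le
    _ = _ := by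
      rw [← exp_add]
      congr 1
      simp only [s]
      field_simp
      ring

/-- let `Ξ = (ξ_1,…,ξ_m)` have `m` mutually independent finite-valued
coordinates (coordinate `i` has distribution `ν i`, so the law of `Ξ` is the product
`PΞ ξ = Π_i ν i (ξ i)`), let `Z = h(Ξ)` with finite range and `P(Z = z) > 0` on the range,
and assume the bounded-differences property with constant `c > 0` for
`ξ ↦ log₂ P(Z = h(ξ))`.  Then for every `n ≥ 1` and `γ > 0`,
`P( −log₂ P(Z = h(Ξ)) − H(Z) > c·√(m·ln(√n/γ)/2) ) ≤ γ/√n`. -/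
theorem mcdiarmid_typicality (m : ℕ) (E : Fin m → Type*) [∀ i, Fintype (E i)]
    (ν : ∀ i, E i → ℝ) (hν0 : ∀ i e, 0 ≤ ν i e) (hν1 : ∀ i, ∑ e, ν i e = 1)
    {β : Type*} [Fintype β] (h : (∀ i, E i) → β)
    (PΞ : (∀ i, E i) → ℝ) (hPΞ : ∀ ξ, PΞ ξ = ∏ i, ν i (ξ i))
    (pZ : β → ℝ) (hpZ : ∀ z, pZ z = ∑ ξ ∈ Finset.univ.filter (fun ξ => h ξ = z), PΞ ξ)
    (hpos : ∀ ξ, 0 < pZ (h ξ))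
    (H : ℝ) (hH : H = -∑ z, pZ z * Real.logb 2 (pZ z))
    (c : ℝ) (hc : 0 < c)
    (hbdd : ∀ (i : Fin m) (ξ ξ' : ∀ i, E i), (∀ j, j ≠ i → ξ j = ξ' j) →
      |Real.logb 2 (pZ (h ξ)) - Real.logb 2 (pZ (h ξ'))| ≤ c)
    (n : ℕ) (hn : 1 ≤ n) (γ : ℝ) (hγ : 0 < γ) :
    ∑ ξ ∈ Finset.univ.filter
        (fun ξ => -Real.logb 2 (pZ (h ξ)) - H > c * Real.sqrt (m * Real.log (Real.sqrt n / γ) / 2)),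
      PΞ ξ ≤ γ / Real.sqrt n := by
  have hw0 : ∀ ξ, 0 ≤ PΞ ξ := fun ξ => by
    rw [hPΞ]
    exact Finset.prod_nonneg fun i _ => hν0 _ _
  have hw1 : ∑ ξ, PΞ ξ = 1 := by
    simp only [hPΞ]
    exact sum_prod_eq_one E ν hν1
  have hn' : 0 < √(n : ℝ) := Real.sqrt_pos.2 (by exact_mod_cast hn)
  have hmean : H = ∑ ξ, PΞ ξ * -Real.logb 2 (pZ (h ξ)) := by
    rw [hH, ← Finset.sum_neg_distrib, ← Finset.sum_fiberwise Finset.univ h]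
    refine Finset.sum_congr rfl fun z _ => ?_
    nth_rw 1 [hpZ z]
    rw [← mul_neg, Finset.sum_mul]
    exact Finset.sum_congr rfl fun ξ hξ => by rw [(Finset.mem_filter.1 hξ).2]
  obtain hL | hL := le_or_gt (Real.log (√n / γ)) 0
  · have hle : √n / γ ≤ 1 := (Real.log_nonpos_iff (by positivity)).1 hL
    calc
      _ ≤ ∑ ξ, PΞ ξ :=
        Finset.sum_le_sum_of_subset_of_nonneg (Finset.filter_subset _ _) fun ξ _ _ => hw0 ξ
      _ = 1 := hw1
      _ ≤ γ / √n := by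
        rw [div_le_one hγ] at hle
        exact (one_le_div hn').2 hle
  obtain rfl | hm := Nat.eq_zero_or_pos m
  · have hH0 : ∀ ξ, H = -Real.logb 2 (pZ (h ξ)) := fun ξ => by
      rw [hmean, Fintype.sum_eq_single ξ fun η hη => absurd (Subsingleton.elim η ξ) hη, hPΞ]
      simp
    rw [Finset.filter_false_of_mem fun ξ _ => by simp [hH0 ξ], Finset.sum_empty]
    positivity
  · have hm' : (0 : ℝ) < m := by exact_mod_cast hm
    have hmcd := sum_filter_prod_le_of_bounded_differences c hc m hm E ν hν0 hν1
      (fun ξ => -Real.logb 2 (pZ (h ξ)))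
      (fun i ξ ξ' hξ => by
        rw [neg_sub_neg, abs_sub_comm]
        exact hbdd i ξ ξ' hξ)
      (c * √(m * Real.log (√n / γ) / 2)) (by positivity)
    simp only [← hPΞ, ← hmean] at hmcd
    refine hmcd.trans_eq ?_
    rw [mul_pow, Real.sq_sqrt (by positivity)]
    have hexp : 2 * (c ^ 2 * (m * Real.log (√n / γ) / 2)) / (m * c ^ 2) = Real.log (√n / γ) := by
      field_simp
    rw [hexp, exp_neg, exp_log (by positivity), inv_div]
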